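/- arXiv:1902.09397 — 2 statements merged into one kernel-verified Lean document; each statement's English description precedes it below -/
import Mathlib

section
/- Let 0 < r < a, γ(t) = a + r·cos t, and let L be the operator (L f)(t) = −(1/r²)·f''(t) + (sin t/(r·γ(t)))·f'(t) acting on smooth functions f : ℝ → ℝ, which is the Laplace–Beltrami operator of the anchor ring restricted to functions of t. Let n₃(t) = −sin t be the third component of the Gauss map of the anchor ring. Then for every integer m ≥ 1 and all real numbers c₁, …, c_m, the function L^m n₃ + c₁·L^{m−1} n₃ + ⋯ + c_{m−1}·L n₃ + c_m·n₃ is not identically zero on ℝ; that is, the Gauss map component n₃ satisfies no monic polynomial relation F(L) n₃ = 0 with real coefficients. -/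
/-- The Laplace–Beltrami operator of the anchor ring's first fundamental form
`I = r² dt² + γ(t)² dφ²` (with `γ(t) = a + r cos t`), restricted to functions of `t`:
`(L f)(t) = −(1/r²)·f''(t) + (sin t/(r·γ(t)))·f'(t)`. -/
noncomputable def Lop (a r : ℝ) (f : ℝ → ℝ) (t : ℝ) : ℝ :=
  -(1 / r ^ 2) * deriv (deriv f) t
    + (Real.sin t / (r * (a + r * Real.cos t))) * deriv f t

open Polynomial

/-- `L` preserves the functions `sin t * g (γ t)`, acting on `g` by a second-order operator. -/
theorem Lop_sin_mul_comp {a r : ℝ} (hr : 0 < r) (hra : r < a) {g g₁ g₂ : ℝ → ℝ}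
    (hg : ∀ u, 0 < u → HasDerivAt g (g₁ u) u) (hg₁ : ∀ u, 0 < u → HasDerivAt g₁ (g₂ u) u) (t : ℝ) :
    Lop a r (fun s => Real.sin s * g (a + r * Real.cos s)) t =
      Real.sin t * (fun u => -(1 / r ^ 2) * (-g u - 3 * (u - a) * g₁ u
        + (r ^ 2 - (u - a) ^ 2) * g₂ u - (u - a) / u * g u
        + (r ^ 2 - (u - a) ^ 2) / u * g₁ u)) (a + r * Real.cos t) := by
  have hpos : ∀ s, 0 < a + r * Real.cos s := fun s => by
    nlinarith [Real.neg_one_le_cos s]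
  have hγ : ∀ s, HasDerivAt (fun s => a + r * Real.cos s) (r * -Real.sin s) s := fun s =>
    ((Real.hasDerivAt_cos s).const_mul r).const_add a
  have h₁ : ∀ s, HasDerivAt (fun s => Real.sin s * g (a + r * Real.cos s))
      (Real.cos s * g (a + r * Real.cos s)
        + Real.sin s * (g₁ (a + r * Real.cos s) * (r * -Real.sin s))) s := fun s =>
    (Real.hasDerivAt_sin s).mul ((hg _ (hpos s)).comp s (hγ s))
  have h₂ := ((Real.hasDerivAt_cos t).mul ((hg _ (hpos t)).comp t (hγ t))).add
    ((Real.hasDerivAt_sin t).mul (((hg₁ _ (hpos t)).comp t (hγ t)).mul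
      ((Real.hasDerivAt_sin t).neg.const_mul r)))
  have hd : deriv (fun s => Real.sin s * g (a + r * Real.cos s)) = fun s =>
      Real.cos s * g (a + r * Real.cos s)
        + Real.sin s * (g₁ (a + r * Real.cos s) * (r * -Real.sin s)) :=
    funext fun s => (h₁ s).deriv
  have hd₂ := h₂.deriv
  simp only [Function.comp_def, Pi.add_def, Pi.mul_def, Pi.neg_def] at hd₂
  have hsin : r ^ 2 - (a + r * Real.cos t - a) ^ 2 = r ^ 2 * Real.sin t ^ 2 := by
    rw [Real.sin_sq]; ring
  unfold Lop
  rw [hd, hd₂]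
  simp only [hsin]
  have hu := (hpos t).ne'
  field_simp
  ring

/-- On `sin t * P(γ) / γ ^ k` with `k ≥ 1`, the operator `L` raises the order of the pole in `γ`
by exactly two. -/
theorem exists_Lop_sin_mul_eval_div {a r : ℝ} (hr : 0 < r) (hra : r < a) (P : ℝ[X])
    (hP : P.eval 0 ≠ 0) (k : ℕ) :
    ∃ Q : ℝ[X], Q.eval 0 ≠ 0 ∧ ∀ t,
      Lop a r (fun s => Real.sin s *
        (P.eval (a + r * Real.cos s) / (a + r * Real.cos s) ^ (k + 1))) t =
      Real.sin t * (Q.eval (a + r * Real.cos t) / (a + r * Real.cos t) ^ (k + 3)) := by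
  let P₁ := X * derivative P - C ((k : ℝ) + 1) * P
  let P₂ := X * derivative P₁ - C ((k : ℝ) + 2) * P₁
  let q : ℝ[X] := C (r ^ 2) - (X - C a) ^ 2
  have hdiv : ∀ (R : ℝ[X]) (n : ℕ) (u : ℝ), 0 < u →
      HasDerivAt (fun u => R.eval u / u ^ (n + 1))
        ((X * derivative R - C ((n : ℝ) + 1) * R).eval u / u ^ (n + 2)) u := fun R n u hu => by
    refine ((R.hasDerivAt u).div (hasDerivAt_pow (n + 1) u) (pow_ne_zero _ hu.ne')).congr_deriv ?_
    simp only [eval_sub, eval_mul, eval_X, eval_C, Nat.cast_add, Nat.cast_one,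
      add_tsub_cancel_right]
    field_simp
    ring
  have h₀ : ∀ u : ℝ, 0 < u → HasDerivAt (fun u => P.eval u / u ^ (k + 1))
      (P₁.eval u / u ^ (k + 2)) u := hdiv P k
  have h₁ : ∀ u : ℝ, 0 < u → HasDerivAt (fun u => P₁.eval u / u ^ (k + 2))
      (P₂.eval u / u ^ (k + 3)) u := fun u hu => by
    have h := hdiv P₁ (k + 1) u hu
    rwa [show ((k + 1 : ℕ) : ℝ) + 1 = k + 2 by push_cast; ring] at h
  refine ⟨C (-(1 / r ^ 2)) * (-(X ^ 2 * P) - 3 * (X - C a) * X * P₁ + q * P₂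
    - (X - C a) * X * P + q * P₁), ?_, fun t => ?_⟩
  · have h : r ^ 2 - a ^ 2 ≠ 0 := by nlinarith
    have hk : (k : ℝ) + 1 ≠ 0 := by positivity
    have e : (C (-(1 / r ^ 2)) * (-(X ^ 2 * P) - 3 * (X - C a) * X * P₁ + q * P₂
        - (X - C a) * X * P + q * P₁)).eval 0 =
        -(1 / r ^ 2) * ((r ^ 2 - a ^ 2) * ((k : ℝ) + 1) ^ 2 * P.eval 0) := by
      simp only [P₁, P₂, q, eval_mul, eval_add, eval_sub, eval_neg, eval_pow, eval_X, eval_C]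
      ring
    rw [e]
    exact mul_ne_zero (neg_ne_zero.2 (by positivity))
      (mul_ne_zero (mul_ne_zero h (pow_ne_zero 2 hk)) hP)
  · have hu : a + r * Real.cos t ≠ 0 := by nlinarith [Real.neg_one_le_cos t]
    rw [Lop_sin_mul_comp hr hra h₀ h₁]
    simp only [eval_mul, eval_add, eval_sub, eval_neg, eval_pow, eval_X, eval_C, eval_ofNat, q]
    field_simp
    ring

/-- `L^j n₃ = sin t * P(γ) / γ ^ (2j - 1)` with `P(0) ≠ 0`. -/
theorem exists_iterate_Lop_neg_sin {a r : ℝ} (hr : 0 < r) (hra : r < a) (j : ℕ) :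
    ∃ P : ℝ[X], P.eval 0 ≠ 0 ∧ ∀ t,
      (Lop a r)^[j] (fun s => -Real.sin s) t =
        Real.sin t * (P.eval (a + r * Real.cos t) / (a + r * Real.cos t) ^ (2 * j - 1)) := by
  induction j with
  | zero => exact ⟨-1, by simp, by simp⟩
  | succ j ih =>
    rcases j with _ | j
    · refine ⟨C (1 / r ^ 2) * (C a - 2 * X), ?_, fun t => ?_⟩
      · have : 0 < a := hr.trans hra
        simp [this.ne', hr.ne']
      · have hu : a + r * Real.cos t ≠ 0 := by nlinarith [Real.neg_one_le_cos t]
        have h := Lop_sin_mul_comp hr hra (g := fun _ => -1) (g₁ := fun _ => 0) (g₂ := fun _ => 0)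
          (fun u _ => hasDerivAt_const u _) (fun u _ => hasDerivAt_const u _) t
        simp only [mul_neg, mul_one] at h
        simp only [zero_add, Function.iterate_one]
        rw [h]
        simp only [eval_mul, eval_sub, eval_X, eval_C, eval_ofNat]
        field_simp
        ring
    · obtain ⟨P, hP, h⟩ := ih
      obtain ⟨Q, hQ, hLQ⟩ := exists_Lop_sin_mul_eval_div hr hra P hP (2 * j)
      refine ⟨Q, hQ, fun t => ?_⟩
      rw [Function.iterate_succ_apply', funext h]
      exact hLQ t

/-- The third Gauss map component `n₃(t) = −sin t` of the anchor ring satisfies no monic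
polynomial relation in `L`: for every `m ≥ 1` and all reals `c₁, …, c_m` (here
`c i` multiplies `L^{m−1−i}` for `i = 0, …, m−1`), the function
`L^m n₃ + c₁·L^{m−1} n₃ + ⋯ + c_{m−1}·L n₃ + c_m·n₃` is not identically zero. -/
theorem anchorRing_n3_no_monic_relation (a r : ℝ) (hr : 0 < r) (hra : r < a)
    (m : ℕ) (hm : 1 ≤ m) (c : Fin m → ℝ) :
    ¬ ∀ t : ℝ,
        (Lop a r)^[m] (fun s => -Real.sin s) t
          + ∑ i : Fin m, c i * (Lop a r)^[m - 1 - (i : ℕ)] (fun s => -Real.sin s) t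
          = 0 := by
  intro H
  have hpos : ∀ s, 0 < a + r * Real.cos s := fun s => by
    nlinarith [Real.neg_one_le_cos s]
  choose P hP hL using exists_iterate_Lop_neg_sin hr hra
  let R : ℝ[X] := P m + ∑ i : Fin m,
    C (c i) * (P (m - 1 - i) * X ^ ((2 * m - 1) - (2 * (m - 1 - i) - 1)))
  have hR0 : R.eval 0 ≠ 0 := by
    have hz : ∀ i : Fin m, (2 * m - 1) - (2 * (m - 1 - (i : ℕ)) - 1) ≠ 0 := fun i => by omega
    simpa [R, eval_finsetSum, hz] using hP m
  have hR : ∀ t, Real.sin t * R.eval (a + r * Real.cos t) = 0 := fun t => by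
    have hu := (hpos t).ne'
    have h := congrArg (· * (a + r * Real.cos t) ^ (2 * m - 1)) (H t)
    simp only [hL, zero_mul, add_mul, Finset.sum_mul] at h
    rw [← h]
    simp only [R, eval_add, eval_finsetSum, eval_mul, eval_C, eval_pow, eval_X, mul_add,
      Finset.mul_sum]
    congr 1
    · field_simp
    · refine Finset.sum_congr rfl fun i _ => ?_
      rw [pow_sub₀ _ hu (by omega)]
      field_simp
  have hzero : R = 0 := by
    refine R.eq_zero_of_infinite_isRoot ((Set.Ioo_infinite (show a < a + r by linarith)).mono ?_)
    intro u hu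
    have hv : (u - a) / r ∈ Set.Ioo (0 : ℝ) 1 :=
      ⟨div_pos (sub_pos.2 hu.1) hr, (div_lt_one hr).2 (by linarith [hu.2])⟩
    have h := hR (Real.arccos ((u - a) / r))
    rw [Real.cos_arccos (by linarith [hv.1]) hv.2.le, mul_div_cancel₀ _ hr.ne', add_sub_cancel,
      Real.sin_arccos] at h
    exact (mul_eq_zero.1 h).resolve_left (Real.sqrt_pos.2 (by nlinarith [hv.1, hv.2])).ne'
  exact hR0 (by simp [hzero])
end

section
/- Let 0 < r < a, γ(t) = a + r·cos t, and let Δ be the operator acting componentwise on smooth maps F : ℝ² → ℝ³ by (ΔF)(t,φ) = −(1/γ(t)²)·∂²F/∂φ² + (sin t/(r·γ(t)))·∂F/∂t − (1/r²)·∂²F/∂t², the Laplace–Beltrami operator of the first fundamental form of the anchor ring. Let n(t,φ) = (−cos t cos φ, −cos t sin φ, −sin t) be the Gauss map of the anchor ring. Then for every integer m ≥ 1 and all real numbers c₁, …, c_m, the map Δ^m n + c₁·Δ^{m−1} n + ⋯ + c_{m−1}·Δ n + c_m·n is not identically zero on ℝ². In other words, the Gauss map of an anchor ring satisfies no monic polynomial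 relation in Δ, so every anchor ring in Euclidean 3-space has Gauss map of infinite type with respect to the first fundamental form. -/
/-- The Laplace–Beltrami operator `Δ = −(1/γ²)∂²/∂φ² + (sin t/(rγ))∂/∂t − (1/r²)∂²/∂t²`
of the anchor ring's first fundamental form `I = r² dt² + γ(t)² dφ²`
(with `γ(t) = a + r cos t`), acting componentwise on maps `ℝ² → ℝ³`. -/
noncomputable def Dop (a r : ℝ) (F : ℝ → ℝ → Fin 3 → ℝ) (t φ : ℝ) : Fin 3 → ℝ :=
  fun i =>
    -(1 / (a + r * Real.cos t) ^ 2) * deriv (fun ψ => deriv (fun ψ' => F t ψ' i) ψ) φ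
      + (Real.sin t / (r * (a + r * Real.cos t))) * deriv (fun s => F s φ i) t
      - (1 / r ^ 2) * deriv (fun s => deriv (fun s' => F s' φ i) s) t

/-- The Gauss map `n(t,φ) = (−cos t cos φ, −cos t sin φ, −sin t)` of the anchor ring. -/
noncomputable def gaussMap (t φ : ℝ) : Fin 3 → ℝ :=
  ![-(Real.cos t * Real.cos φ), -(Real.cos t * Real.sin φ), -Real.sin t]

open Polynomial in
/-- The action of the Laplacian on maps `sin t · p(1/γ(t))`, written on the polynomial `p`. -/
noncomputable def ringLap (a r : ℝ) (p : ℝ[X]) : ℝ[X] :=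
  C (1 / r ^ 2) * (2 * p - C a * (X * p)
    + (X * derivative (X * derivative p)
      - C (2 * a) * (X * (X * derivative (X * derivative p)))
      + C (a ^ 2 - r ^ 2) * (X * (X * (X * derivative (X * derivative p)))))
    - C 3 * (X * derivative p) + C (3 * a) * (X * (X * derivative p)))

open Polynomial in
lemma coeff_X_mul_derivative (p : ℝ[X]) (n : ℕ) :
    (X * derivative p).coeff n = n * p.coeff n := by
  cases n with
  | zero => simp
  | succ n => rw [coeff_X_mul, coeff_derivative]; push_cast; ring

lemma coeff_ringLap (a r : ℝ) (p : Polynomial ℝ) (n : ℕ) :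
    (ringLap a r p).coeff (n + 2) = 1 / r ^ 2 * (2 * p.coeff (n + 2) - a * p.coeff (n + 1)
      + ((n + 2) ^ 2 * p.coeff (n + 2) - 2 * a * ((n + 1) ^ 2 * p.coeff (n + 1))
        + (a ^ 2 - r ^ 2) * (n ^ 2 * p.coeff n))
      - 3 * ((n + 2) * p.coeff (n + 2)) + 3 * a * ((n + 1) * p.coeff (n + 1))) := by
  have h2 : (2 : Polynomial ℝ) = Polynomial.C 2 := rfl
  simp only [ringLap, h2, Polynomial.coeff_C_mul, Polynomial.coeff_add, Polynomial.coeff_sub,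
    coeff_X_mul_derivative, Polynomial.coeff_X_mul, Polynomial.coeff_derivative]
  push_cast
  ring

lemma coeff_ringLap_eq_zero (a r : ℝ) {p : Polynomial ℝ} {d : ℕ}
    (h : ∀ n, d < n → p.coeff n = 0) (n : ℕ) (hn : d + 2 < n) :
    (ringLap a r p).coeff n = 0 := by
  obtain ⟨k, rfl⟩ : ∃ k, n = k + 2 := ⟨n - 2, by omega⟩
  rw [coeff_ringLap, h (k + 2) (by omega), h (k + 1) (by omega), h k (by omega)]
  ring

lemma coeff_ringLap_top (a r : ℝ) {p : Polynomial ℝ} {d : ℕ}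
    (h : ∀ n, d < n → p.coeff n = 0) :
    (ringLap a r p).coeff (d + 2) = (a ^ 2 - r ^ 2) / r ^ 2 * d ^ 2 * p.coeff d := by
  rw [coeff_ringLap, h (d + 2) (by omega), h (d + 1) (by omega)]
  ring

lemma ringLap_neg_one (a r : ℝ) :
    ringLap a r (-1) = Polynomial.C (1 / r ^ 2) * (Polynomial.C a * Polynomial.X - 2) := by
  simp only [ringLap, Polynomial.derivative_neg, Polynomial.derivative_one, neg_zero, mul_zero,
    Polynomial.derivative_zero]
  ring

/-- The iterates have pole order exactly `2k + 1` in `γ`. -/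
lemma ringLap_iterate_coeff (a r : ℝ) (hr : 0 < r) (hra : r < a) (k : ℕ) :
    (∀ n, 2 * k + 1 < n → ((ringLap a r)^[k + 1] (-1)).coeff n = 0) ∧
      ((ringLap a r)^[k + 1] (-1)).coeff (2 * k + 1) ≠ 0 := by
  induction k with
  | zero =>
    have h2 : (2 : Polynomial ℝ) = Polynomial.C 2 := rfl
    simp only [zero_add, Function.iterate_one, ringLap_neg_one, h2]
    refine ⟨fun n hn => ?_, ?_⟩
    · simp [Polynomial.coeff_C, Polynomial.coeff_X, show 1 ≠ n by omega, show n ≠ 0 by omega]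
    · simp [Polynomial.coeff_C, hr.ne', (hr.trans hra).ne']
  | succ k ih =>
    rw [Function.iterate_succ_apply']
    refine ⟨coeff_ringLap_eq_zero a r ih.1, ?_⟩
    rw [show 2 * (k + 1) + 1 = 2 * k + 1 + 2 by ring, coeff_ringLap_top a r ih.1]
    have : 0 < a ^ 2 - r ^ 2 := by nlinarith
    exact mul_ne_zero (by positivity) ih.2

lemma ringLap_iterate_coeff_eq_zero (a r : ℝ) (hr : 0 < r) (hra : r < a) {k m : ℕ} (h : k ≤ m) :
    ((ringLap a r)^[k] (-1)).coeff (2 * m + 1) = 0 := by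
  cases k with
  | zero => simp [Polynomial.coeff_one]
  | succ k => exact (ringLap_iterate_coeff a r hr hra k).1 _ (by omega)

lemma anchorRing_radius_pos {a r : ℝ} (hr : 0 < r) (hra : r < a) (t : ℝ) :
    0 < a + r * Real.cos t := by
  nlinarith [Real.neg_one_le_cos t]

lemma hasDerivAt_eval_inv_radius {a r : ℝ} (hr : 0 < r) (hra : r < a) (p : Polynomial ℝ) (t : ℝ) :
    HasDerivAt (fun s => p.eval (a + r * Real.cos s)⁻¹)
      (p.derivative.eval (a + r * Real.cos t)⁻¹
        * (r * Real.sin t * (a + r * Real.cos t)⁻¹ ^ 2)) t := by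
  have h1 : HasDerivAt (fun s => a + r * Real.cos s) (r * -Real.sin t) t :=
    ((Real.hasDerivAt_cos t).const_mul r).const_add a
  refine ((p.hasDerivAt _).comp t (h1.fun_inv (anchorRing_radius_pos hr hra t).ne')).congr_deriv ?_
  rw [inv_pow]
  ring

lemma Dop_apply_two {a r : ℝ} (hr : 0 < r) (hra : r < a) {F : ℝ → ℝ → Fin 3 → ℝ}
    {p : Polynomial ℝ} (hF : ∀ t φ, F t φ 2 = Real.sin t * p.eval (a + r * Real.cos t)⁻¹)
    (t φ : ℝ) :
    Dop a r F t φ 2 = Real.sin t * (ringLap a r p).eval (a + r * Real.cos t)⁻¹ := by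
  have hd1 : ∀ s, HasDerivAt (fun s => Real.sin s * p.eval (a + r * Real.cos s)⁻¹) _ s :=
    fun s => (Real.hasDerivAt_sin s).mul (hasDerivAt_eval_inv_radius hr hra p s)
  have hsq := hasDerivAt_eval_inv_radius hr hra (Polynomial.X ^ 2) t
  have hd2 := ((Real.hasDerivAt_cos t).mul (hasDerivAt_eval_inv_radius hr hra p t)).add
    ((Real.hasDerivAt_sin t).mul ((hasDerivAt_eval_inv_radius hr hra p.derivative t).mul
      (((Real.hasDerivAt_sin t).const_mul r).mul hsq)))
  simp only [Polynomial.eval_pow, Polynomial.eval_X] at hd2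
  simp only [Dop, hF, deriv_const, fun s => (hd1 s).deriv]
  rw [show deriv (fun s => Real.cos s * p.eval (a + r * Real.cos s)⁻¹ + Real.sin s *
    (p.derivative.eval (a + r * Real.cos s)⁻¹
      * (r * Real.sin s * (a + r * Real.cos s)⁻¹ ^ 2))) t = _ from hd2.deriv]
  have hγ := (anchorRing_radius_pos hr hra t).ne'
  simp only [Pi.mul_apply, ringLap, Polynomial.derivative_mul, Polynomial.derivative_X,
    Polynomial.eval_add,
    Polynomial.eval_sub, Polynomial.eval_mul, Polynomial.eval_C, Polynomial.eval_X,
    Polynomial.eval_ofNat, Polynomial.derivative_X_sq, Polynomial.eval_one]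
  have hs := Real.sin_sq t
  generalize Polynomial.eval (a + r * Real.cos t)⁻¹ p = p₀
  generalize Polynomial.eval (a + r * Real.cos t)⁻¹ (Polynomial.derivative p) = p₁
  generalize Polynomial.eval (a + r * Real.cos t)⁻¹
    (Polynomial.derivative (Polynomial.derivative p)) = p₂
  have hr' := hr.ne'
  linear_combination (norm := skip) (Real.sin t * (-p₁ * (a + r * Real.cos t)⁻¹ ^ 3
    - p₂ * (a + r * Real.cos t)⁻¹ ^ 4)) * hs
  field_simp
  ring

lemma Dop_iterate_gaussMap_two {a r : ℝ} (hr : 0 < r) (hra : r < a) (k : ℕ) (t φ : ℝ) :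
    (Dop a r)^[k] gaussMap t φ 2
      = Real.sin t * ((ringLap a r)^[k] (-1)).eval (a + r * Real.cos t)⁻¹ := by
  induction k generalizing t φ with
  | zero => simp [gaussMap]
  | succ k ih =>
    simp only [Function.iterate_succ_apply']
    exact Dop_apply_two hr hra ih t φ

/-- Every anchor ring in Euclidean 3-space has Gauss map of infinite type with respect to
the first fundamental form: for every `m ≥ 1` and all reals `c₁, …, c_m` (here `c i`
multiplies `Δ^{m−1−i}` for `i = 0, …, m−1`), the map
`Δ^m n + c₁·Δ^{m−1} n + ⋯ + c_{m−1}·Δ n + c_m·n` is not identically zero on ℝ². -/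
theorem anchorRing_gaussMap_infinite_type (a r : ℝ) (hr : 0 < r) (hra : r < a)
    (m : ℕ) (hm : 1 ≤ m) (c : Fin m → ℝ) :
    ¬ ∀ t φ : ℝ,
        (Dop a r)^[m] gaussMap t φ
          + ∑ i : Fin m, c i • (Dop a r)^[m - 1 - (i : ℕ)] gaussMap t φ
          = 0 := by
  intro h
  obtain ⟨k, rfl⟩ : ∃ k, m = k + 1 := ⟨m - 1, by omega⟩
  set P : Polynomial ℝ := (ringLap a r)^[k + 1] (-1)
    + ∑ i : Fin (k + 1), Polynomial.C (c i) * (ringLap a r)^[k + 1 - 1 - (i : ℕ)] (-1) with hP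
  have hroot : ∀ t ∈ Set.Ioo 0 Real.pi, P.eval (a + r * Real.cos t)⁻¹ = 0 := by
    intro t ht
    have h2 := congrFun (h t 0) 2
    simp only [Pi.add_apply, Finset.sum_apply, Pi.smul_apply, smul_eq_mul, Pi.zero_apply,
      Dop_iterate_gaussMap_two hr hra] at h2
    have : Real.sin t * P.eval (a + r * Real.cos t)⁻¹ = 0 := by
      rw [← h2, hP, Polynomial.eval_add, Polynomial.eval_finsetSum, mul_add, Finset.mul_sum]
      congr 1
      refine Finset.sum_congr rfl fun i _ => ?_
      rw [Polynomial.eval_mul, Polynomial.eval_C]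
      ring
    exact (mul_eq_zero.mp this).resolve_left (Real.sin_pos_of_mem_Ioo ht).ne'
  have hinj : Set.InjOn (fun t => (a + r * Real.cos t)⁻¹) (Set.Ioo 0 Real.pi) := by
    intro s hs t ht hst
    have hcos : Real.cos s = Real.cos t :=
      mul_left_cancel₀ hr.ne' (add_left_cancel (inv_injective hst))
    exact Real.injOn_cos (Set.Ioo_subset_Icc_self hs) (Set.Ioo_subset_Icc_self ht) hcos
  have hP0 : P = 0 := by
    refine Polynomial.eq_zero_of_infinite_isRoot P
      (((Set.Ioo_infinite Real.pi_pos).image hinj).mono ?_)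
    rintro _ ⟨t, ht, rfl⟩
    exact hroot t ht
  have hcoeff : P.coeff (2 * k + 1) = ((ringLap a r)^[k + 1] (-1)).coeff (2 * k + 1) := by
    rw [hP, Polynomial.coeff_add, Polynomial.finsetSum_coeff, Finset.sum_eq_zero, add_zero]
    intro i _
    rw [Polynomial.coeff_C_mul, ringLap_iterate_coeff_eq_zero a r hr hra (by omega), mul_zero]
  rw [hP0, Polynomial.coeff_zero] at hcoeff
  exact (ringLap_iterate_coeff a r hr hra k).2 hcoeff.symm
end
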